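/- arXiv:1111.6717 — 5 statements merged into one kernel-verified Lean document; each statement's English description precedes it below -/
import Mathlib

section
/- Let q ≥ 1 be an integer, let b, b′ : ℕ → ℤ be sequences of integers with b_i ≡ b′_i (mod q) for all i, and let x, ν : ℕ → ℝ be sequences with x_0 = ν_0 and x_1 = ν_1 lying in (1/q)ℤ ∩ (0,1], satisfying the recursions x_{i+1} = ⟨b_i·x_i − x_{i−1}⟩ and ν_{i+1} = ⟨b′_i·ν_i − ν_{i−1}⟩ for all i ≥ 1. Then x_i = ν_i for all i ≥ 0, and every x_i lies in (1/q)ℤ ∩ (0,1]. -/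
/-- `⟨t⟩` is `t - ⌊t⌋` if `t` is not an integer, and `1` if `t` is an integer, so that
`⟨t⟩ ∈ (0,1]` and `⟨t + m⟩ = ⟨t⟩` for every integer `m`. -/
noncomputable def pfrac (t : ℝ) : ℝ := if Int.fract t = 0 then 1 else Int.fract t

theorem pfrac_add_intCast (t : ℝ) (n : ℤ) : pfrac (t + n) = pfrac t := by
  simp only [pfrac, Int.fract_add_intCast]

theorem pfrac_mem_Ioc (t : ℝ) : pfrac t ∈ Set.Ioc (0 : ℝ) 1 := by
  unfold pfrac
  split_ifs with h
  · simp
  · exact ⟨lt_of_le_of_ne (Int.fract_nonneg t) (Ne.symm h), (Int.fract_lt_one t).le⟩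

theorem exists_pfrac_eq_add_intCast (t : ℝ) : ∃ n : ℤ, pfrac t = t + n := by
  unfold pfrac
  split_ifs with h
  · refine ⟨1 - ⌊t⌋, ?_⟩
    have := Int.self_sub_floor t
    push_cast
    linarith
  · refine ⟨-⌊t⌋, ?_⟩
    rw [← Int.self_sub_floor]
    push_cast
    ring

/-- If `b, b' : ℕ → ℤ` satisfy `b i ≡ b' i (mod q)` for all `i`, and `x, ν : ℕ → ℝ` have
the same initial values `x 0 = ν 0`, `x 1 = ν 1` lying in `(1/q)ℤ ∩ (0,1]` and satisfy
the recursions `x (i+1) = ⟨b i * x i - x (i-1)⟩`, `ν (i+1) = ⟨b' i * ν i - ν (i-1)⟩`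
for `i ≥ 1`, then `x i = ν i` for all `i`, and every `x i` lies in `(1/q)ℤ ∩ (0,1]`. -/
theorem recursion_depends_only_on_residues
    (q : ℕ) (hq : 1 ≤ q) (b b' : ℕ → ℤ)
    (hcong : ∀ i : ℕ, b i ≡ b' i [ZMOD (q : ℤ)])
    (x ν : ℕ → ℝ)
    (hx0 : x 0 = ν 0) (hx1 : x 1 = ν 1)
    (h0q : ∃ m : ℤ, x 0 = (m : ℝ) / q) (h0mem : x 0 ∈ Set.Ioc (0 : ℝ) 1)
    (h1q : ∃ m : ℤ, x 1 = (m : ℝ) / q) (h1mem : x 1 ∈ Set.Ioc (0 : ℝ) 1)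
    (hxrec : ∀ i : ℕ, 1 ≤ i → x (i + 1) = pfrac ((b i : ℝ) * x i - x (i - 1)))
    (hνrec : ∀ i : ℕ, 1 ≤ i → ν (i + 1) = pfrac ((b' i : ℝ) * ν i - ν (i - 1))) :
    (∀ i : ℕ, x i = ν i) ∧
    (∀ i : ℕ, (∃ m : ℤ, x i = (m : ℝ) / q) ∧ x i ∈ Set.Ioc (0 : ℝ) 1) := by
  have hq0 : (q : ℝ) ≠ 0 := by positivity
  have key : ∀ i : ℕ, (x i = ν i ∧ (∃ m : ℤ, x i = (m : ℝ) / q) ∧ x i ∈ Set.Ioc (0 : ℝ) 1) ∧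
      (x (i + 1) = ν (i + 1) ∧ (∃ m : ℤ, x (i + 1) = (m : ℝ) / q) ∧
        x (i + 1) ∈ Set.Ioc (0 : ℝ) 1) := by
    intro i
    induction i with
    | zero => exact ⟨⟨hx0, h0q, h0mem⟩, hx1, h1q, h1mem⟩
    | succ i ih =>
      refine ⟨ih.2, ?_⟩
      obtain ⟨⟨heq, ⟨m, hm⟩, -⟩, heq', ⟨m', hm'⟩, -⟩ := ih
      have hx := hxrec (i + 1) (by omega)
      have hν := hνrec (i + 1) (by omega)
      rw [Nat.add_sub_cancel] at hx hν
      refine ⟨?_, ?_, hx ▸ pfrac_mem_Ioc _⟩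
      · obtain ⟨k, hk⟩ := (hcong (i + 1)).dvd
        have hb : (b' (i + 1) : ℝ) = b (i + 1) + q * k := by
          exact_mod_cast eq_add_of_sub_eq' hk
        have harg : (b' (i + 1) : ℝ) * x (i + 1) - x i =
            (b (i + 1) : ℝ) * x (i + 1) - x i + ((k * m' : ℤ) : ℝ) := by
          rw [hb, hm']
          push_cast
          field_simp
          ring
        rw [hx, hν, ← heq, ← heq', harg, pfrac_add_intCast]
      · obtain ⟨n, hn⟩ := exists_pfrac_eq_add_intCast ((b (i + 1) : ℝ) * x (i + 1) - x i)
        refine ⟨b (i + 1) * m' - m + n * q, ?_⟩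
        rw [hx, hn, hm, hm']
        push_cast
        field_simp
  exact ⟨fun i => (key i).1.1, fun i => (key i).1.2⟩
end

section
/- Let n ≥ 1 be an integer such that n² + 2 is squarefree, and let K = ℚ(√(n²+2)) with ring of integers 𝒪_K. Then ε = n² + 1 + n√(n²+2) is a totally positive unit of 𝒪_K, and every totally positive unit of 𝒪_K is an integer power of ε (that is, ε is the totally positive fundamental unit of K). -/
open NumberField

section QuadraticField

variable {K : Type*} [Field K] [Algebra ℚ K] {d : ℤ} {α : K}

lemma Int.not_isSquare_of_emod_four (hd : d % 4 = 2 ∨ d % 4 = 3) : ¬ IsSquare d := by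
  rintro ⟨r, rfl⟩
  rcases (by omega : r % 4 = 0 ∨ r % 4 = 1 ∨ r % 4 = 2 ∨ r % 4 = 3) with h | h | h | h <;>
    simp [Int.mul_emod, h] at hd

/-- A quadratic field generated by `α` with `α ^ 2 = d` is the quadratic algebra `ℚ[√d]`. -/
lemma exists_algEquiv_quadraticAlgebra (hrank : Module.finrank ℚ K = 2) (hd : ¬ IsSquare d)
    (hα : α ^ 2 = d) :
    ∃ e : QuadraticAlgebra ℚ (d : ℚ) 0 ≃ₐ[ℚ] K, ∀ z, e z = (z.re : K) + z.im * α := by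
  have : Fact (∀ r : ℚ, r ^ 2 ≠ (d : ℚ) + 0 * r) := ⟨fun r hr =>
    hd (Rat.isSquare_intCast_iff.mp ⟨r, by rw [← sq, hr]; ring⟩)⟩
  have : CharZero K := algebraRat.charZero K
  have : FiniteDimensional ℚ K := Module.finite_of_finrank_eq_succ hrank
  let f := QuadraticAlgebra.lift (R := ℚ) (a := (d : ℚ)) (b := 0)
    ⟨α, by simp [← sq, hα, Algebra.smul_def]⟩
  have hf : Function.Injective f := f.toRingHom.injective
  have hf' : Function.Bijective f := ⟨hf,
    (LinearMap.injective_iff_surjective_of_finrank_eq_finrank (f := f.toLinearMap)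
      (by rw [hrank, QuadraticAlgebra.finrank_eq_two])).mp hf⟩
  exact ⟨AlgEquiv.ofBijective f hf', fun z => by simp [f, Algebra.smul_def]⟩

lemma exists_rat_add_mul (hrank : Module.finrank ℚ K = 2) (hd : ¬ IsSquare d)
    (hα : α ^ 2 = d) (x : K) : ∃ p q : ℚ, x = p + q * α := by
  obtain ⟨e, he⟩ := exists_algEquiv_quadraticAlgebra hrank hd hα
  exact ⟨(e.symm x).re, (e.symm x).im, by rw [← he, e.apply_symm_apply]⟩

lemma exists_algHom_apply_eq (hrank : Module.finrank ℚ K = 2) (hd : ¬ IsSquare d)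
    (hα : α ^ 2 = d) {L : Type*} [Field L] [Algebra ℚ L] {s : L} (hs : s ^ 2 = d) :
    ∃ φ : K →ₐ[ℚ] L, φ α = s := by
  obtain ⟨e, he⟩ := exists_algEquiv_quadraticAlgebra hrank hd hα
  let f := QuadraticAlgebra.lift (R := ℚ) (a := (d : ℚ)) (b := 0)
    ⟨s, by simp [← sq, hs, Algebra.smul_def]⟩
  refine ⟨f.comp e.symm, ?_⟩
  have h : e.symm α = ⟨0, 1⟩ := by rw [AlgEquiv.symm_apply_eq, he]; simp
  simp [h, f]

lemma Rat.exists_int_of_squarefree_mul_sq (hsf : Squarefree d) {q : ℚ} {m : ℤ}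
    (h : d * q ^ 2 = m) : ∃ b : ℤ, q = b := by
  have hq : (q.den : ℚ) ≠ 0 := by exact_mod_cast q.den_ne_zero
  have h1 : d * q.num ^ 2 = m * (q.den : ℤ) ^ 2 := by
    rw [← Rat.num_div_den q] at h
    field_simp at h
    rw [mul_comm m]
    exact_mod_cast h
  have hco : IsCoprime ((q.den : ℤ) ^ 2) (q.num ^ 2) :=
    (Int.isCoprime_iff_nat_coprime.mpr (by simpa using q.reduced)).symm.pow
  have h2 : (q.den : ℤ) * q.den ∣ d := by
    rw [← sq]
    exact hco.dvd_of_dvd_mul_right ⟨m, by rw [h1]; ring⟩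
  have h3 : q.den = 1 := by
    have := Int.isUnit_iff.mp (hsf _ h2)
    have := q.den_pos
    omega
  exact ⟨q.num, (Rat.den_eq_one_iff q).mp h3 |>.symm⟩

lemma Int.even_of_four_dvd_sq_sub_mul_sq (hd : d % 4 = 2 ∨ d % 4 = 3) {a b : ℤ}
    (h : 4 ∣ a ^ 2 - d * b ^ 2) : Even a ∧ Even b := by
  have h0 := Int.emod_eq_zero_of_dvd h
  rw [Int.even_iff, Int.even_iff]
  have key : ∀ x : ℤ, x % 2 = 0 ∧ x ^ 2 % 4 = 0 ∨ x % 2 = 1 ∧ x ^ 2 % 4 = 1 := by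
    intro x
    rcases Int.even_or_odd' x with ⟨c, rfl | rfl⟩
    · left; ring_nf; omega
    · right; ring_nf; omega
  rw [Int.sub_emod, Int.mul_emod] at h0
  rcases key a with ⟨ha, ha'⟩ | ⟨ha, ha'⟩ <;> rcases key b with ⟨hb, hb'⟩ | ⟨hb, hb'⟩ <;>
    rcases hd with hd | hd <;> simp_all

/-- For squarefree `d ≡ 2, 3 mod 4`, the algebraic integers of `ℚ(√d)` lie in `ℤ[√d]`. -/
lemma exists_int_add_mul_of_isIntegral (hrank : Module.finrank ℚ K = 2) (hsf : Squarefree d)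
    (hd : d % 4 = 2 ∨ d % 4 = 3) (hα : α ^ 2 = d) {x : K} (hx : IsIntegral ℤ x) :
    ∃ a b : ℤ, x = a + b * α := by
  have hd' := Int.not_isSquare_of_emod_four hd
  have : CharZero K := algebraRat.charZero K
  obtain ⟨p, q, rfl⟩ := exists_rat_add_mul hrank hd' hα x
  obtain ⟨σ, hσ⟩ := exists_algHom_apply_eq hrank hd' hα (L := K) (s := -α) (by rw [neg_sq, hα])
  have hx' : IsIntegral ℤ ((p : K) - q * α) := by
    have := hx.map (σ.toRingHom.toIntAlgHom)
    simpa [hσ, ← sub_eq_add_neg] using this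
  have int_of_rat : ∀ r : ℚ, IsIntegral ℤ (r : K) → ∃ m : ℤ, r = m := by
    intro r hr
    have hr' : IsIntegral ℤ r := by
      refine (isIntegral_algebraMap_iff (algebraMap ℚ K).injective).mp ?_
      simpa using hr
    obtain ⟨m, hm⟩ := IsIntegrallyClosed.isIntegral_iff.mp hr'
    exact ⟨m, by simpa using hm.symm⟩
  obtain ⟨A, hA⟩ := int_of_rat (2 * p) (by
    have h : ((2 * p : ℚ) : K) = (p + q * α) + (p - q * α) := by push_cast; ring
    exact h ▸ hx.add hx')
  obtain ⟨N, hN⟩ := int_of_rat (p ^ 2 - d * q ^ 2) (by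
    have h : ((p ^ 2 - d * q ^ 2 : ℚ) : K) = (p + q * α) * (p - q * α) := by
      push_cast
      rw [← hα]
      ring
    exact h ▸ hx.mul hx')
  obtain ⟨B, hB⟩ := Rat.exists_int_of_squarefree_mul_sq hsf (q := 2 * q) (m := A ^ 2 - 4 * N) (by
    push_cast
    rw [← hA, ← hN]
    ring)
  have hdvd : 4 ∣ A ^ 2 - d * B ^ 2 := ⟨N, by
    have : (A : ℚ) ^ 2 - d * (B : ℚ) ^ 2 = 4 * N := by
      rw [← hA, ← hB, ← hN]
      ring
    exact_mod_cast this⟩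
  obtain ⟨⟨a, rfl⟩, ⟨b, rfl⟩⟩ := Int.even_of_four_dvd_sq_sub_mul_sq hd hdvd
  have hp : p = a := by push_cast at hA; linarith
  have hq : q = b := by push_cast at hB; linarith
  exact ⟨a, b, by simp [hp, hq]⟩

end QuadraticField

/-- The solution `(n² + 1, n)` of the Pell equation for `n² + 2`. -/
def nSqAddTwoSolution (n : ℕ) : Pell.Solution₁ ((n : ℤ) ^ 2 + 2) :=
  .mk ((n : ℤ) ^ 2 + 1) n (by ring)

lemma isFundamental_nSqAddTwoSolution {n : ℕ} (hn : 1 ≤ n) :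
    Pell.IsFundamental (nSqAddTwoSolution n) := by
  refine ⟨by simp [nSqAddTwoSolution]; positivity, by simp [nSqAddTwoSolution]; omega, ?_⟩
  intro s hs
  simp only [nSqAddTwoSolution, Pell.Solution₁.x_mk]
  have hp := s.prop_x
  rw [← sq_abs s.y] at hp
  have hy : 0 < |s.y| := by
    rw [abs_pos]
    intro h0
    rw [h0] at hp
    simp at hp
    omega
  generalize |s.y| = b at *
  generalize s.x = a at *
  have hn' : (1 : ℤ) ≤ n := by exact_mod_cast hn
  generalize (n : ℤ) = m at *
  rcases le_or_gt m b with h | h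
  · refine Int.lt_add_one_iff.mp (lt_of_pow_lt_pow_left₀ 2 (by omega) ?_)
    nlinarith [mul_le_mul h h (by omega) (by omega)]
  · exfalso
    have h1 : m * b < a := lt_of_pow_lt_pow_left₀ 2 (by omega) (by nlinarith)
    have h2 : a < m * b + 1 := lt_of_pow_lt_pow_left₀ 2 (by nlinarith) (by nlinarith)
    omega

/-- The unit `x + y√d` attached to a solution `(x, y)` of the Pell equation. -/
def pellUnitsHom {R : Type*} [CommRing R] {d : ℤ} (r : { r : R // r * r = d }) :
    Pell.Solution₁ d →* Rˣ :=
  (Units.map (Zsqrtd.lift r : ℤ√d →+* R).toMonoidHom).comp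
    (Unitary.toUnits : unitary (ℤ√d) →* (ℤ√d)ˣ)

lemma coe_pellUnitsHom {R : Type*} [CommRing R] {d : ℤ} (r : { r : R // r * r = d })
    (s : Pell.Solution₁ d) : (pellUnitsHom r s : R) = s.x + s.y * r := rfl

/-- Let `n ≥ 1` with `n² + 2` squarefree, and let `K = ℚ(√(n²+2))` (an abstract number
field of degree 2 over ℚ containing an element `α` with `α² = n² + 2`).  Then
`ε = n² + 1 + n·α` is a totally positive unit of `𝒪_K`, and every totally positive
unit of `𝒪_K` is an integer power of `ε`. -/
theorem totally_positive_fundamental_unit_n_sq_add_two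
    (n : ℕ) (hn : 1 ≤ n) (hsf : Squarefree (n ^ 2 + 2))
    (K : Type*) [Field K] [NumberField K] (hrank : Module.finrank ℚ K = 2)
    (α : K) (hα : α ^ 2 = (n : K) ^ 2 + 2) :
    ∃ ε : (𝓞 K)ˣ,
      (((ε : 𝓞 K) : K) = (n : K) ^ 2 + 1 + (n : K) * α) ∧
      (∀ φ : K →+* ℝ, 0 < φ ((ε : 𝓞 K) : K)) ∧
      (∀ u : (𝓞 K)ˣ, (∀ φ : K →+* ℝ, 0 < φ ((u : 𝓞 K) : K)) → ∃ k : ℤ, u = ε ^ k) := by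
  have hsf' : Squarefree ((n : ℤ) ^ 2 + 2) := by
    exact_mod_cast Int.squarefree_natCast.mpr hsf
  have hmod : ((n : ℤ) ^ 2 + 2) % 4 = 2 ∨ ((n : ℤ) ^ 2 + 2) % 4 = 3 := by
    rcases Int.even_or_odd' (n : ℤ) with ⟨c, h | h⟩ <;> rw [h] <;> ring_nf <;> omega
  have hd := Int.not_isSquare_of_emod_four hmod
  have hα' : α ^ 2 = (((n : ℤ) ^ 2 + 2 : ℤ) : K) := by push_cast; exact hα
  have hαint : IsIntegral ℤ α := by
    refine IsIntegral.of_pow two_pos ?_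
    rw [hα']
    exact isIntegral_algebraMap (R := ℤ) (x := (n : ℤ) ^ 2 + 2)
  obtain ⟨β, hβ⟩ : ∃ β : 𝓞 K, (β : K) = α := ⟨⟨α, hαint⟩, rfl⟩
  let r : { r : 𝓞 K // r * r = (((n : ℤ) ^ 2 + 2 : ℤ) : 𝓞 K) } :=
    ⟨β, by
      apply RingOfIntegers.coe_injective
      rw [map_mul, map_intCast, ← hα', sq, ← hβ]⟩
  have hr : ((r : 𝓞 K) : K) = α := hβ
  have hfund := isFundamental_nSqAddTwoSolution hn
  have hε : ((pellUnitsHom r (nSqAddTwoSolution n) : 𝓞 K) : K) =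
      (n : K) ^ 2 + 1 + (n : K) * α := by
    simp [coe_pellUnitsHom, nSqAddTwoSolution, hr]
  refine ⟨pellUnitsHom r (nSqAddTwoSolution n), hε, fun φ => ?_, fun u hu => ?_⟩
  · have hs : φ α ^ 2 = (n : ℝ) ^ 2 + 2 := by
      rw [← map_pow, hα, map_add, map_pow, map_natCast, map_ofNat]
    rw [hε]
    simp only [map_add, map_pow, map_natCast, map_one, map_mul]
    nlinarith [sq_nonneg ((n : ℝ) ^ 2 + 1 + n * φ α), sq_nonneg (n : ℝ)]
  · obtain ⟨a, b, hab⟩ : ∃ a b : ℤ, ((u : 𝓞 K) : K) = a + b * α :=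
      exists_int_add_mul_of_isIntegral hrank hsf' hmod hα'
        (u : 𝓞 K).isIntegral_coe
    obtain ⟨a', b', hab'⟩ : ∃ a b : ℤ, (((u⁻¹ : (𝓞 K)ˣ) : 𝓞 K) : K) = a + b * α :=
      exists_int_add_mul_of_isIntegral hrank hsf' hmod hα'
        ((u⁻¹ : (𝓞 K)ˣ) : 𝓞 K).isIntegral_coe
    have huu : ((u : 𝓞 K) : K) * ((u⁻¹ : (𝓞 K)ˣ) : 𝓞 K) = 1 := by
      rw [← map_mul, Units.mul_inv, map_one]
    set s : ℝ := √((n : ℝ) ^ 2 + 2)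
    have hs : s ^ 2 = (n : ℝ) ^ 2 + 2 := Real.sq_sqrt (by positivity)
    obtain ⟨φ, hφ⟩ := exists_algHom_apply_eq hrank hd hα' (L := ℝ) (s := s) (by simp [hs])
    obtain ⟨ψ, hψ⟩ := exists_algHom_apply_eq hrank hd hα' (L := ℝ) (s := -s) (by simp [hs])
    have h1 := hu φ.toRingHom
    have h2 := hu ψ.toRingHom
    have e1 := congrArg φ huu
    have e2 := congrArg ψ huu
    rw [hab, hab'] at e1 e2
    rw [hab] at h1 h2
    simp [hφ] at h1 e1
    simp [hψ] at h2 e2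
    have hnorm : ((a : ℝ) ^ 2 - (n ^ 2 + 2) * b ^ 2) * (a' ^ 2 - (n ^ 2 + 2) * b' ^ 2) = 1 := by
      rw [← hs]
      linear_combination (a + b * -s) * (a' + b' * -s) * e1 + e2
    have hpos : (0 : ℝ) < (a : ℝ) ^ 2 - (n ^ 2 + 2) * b ^ 2 := by
      rw [← hs]
      nlinarith [mul_pos h1 (sub_pos.mpr h2)]
    have ha : 0 < a := by
      have : (0 : ℝ) < a := by linarith
      exact_mod_cast this
    have hpell : a ^ 2 - ((n : ℤ) ^ 2 + 2) * b ^ 2 = 1 :=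
      (Int.eq_one_or_neg_one_of_mul_eq_one (by exact_mod_cast hnorm)).resolve_right fun h => by
        have : 0 < a ^ 2 - ((n : ℤ) ^ 2 + 2) * b ^ 2 := by exact_mod_cast hpos
        omega
    let t : Pell.Solution₁ ((n : ℤ) ^ 2 + 2) := .mk a b hpell
    have ht : u = pellUnitsHom r t := by
      apply Units.ext
      apply RingOfIntegers.ext
      simp [coe_pellUnitsHom, t, hr, hab]
    obtain ⟨k, hk | hk⟩ := hfund.eq_zpow_or_neg_zpow t
    · exact ⟨k, by rw [ht, hk, map_zpow]⟩
    · have hx := Pell.Solution₁.x_zpow_pos hfund.x_pos k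
      have hx' : t.x = -(nSqAddTwoSolution n ^ k).x := by rw [hk, Pell.Solution₁.x_neg]
      have : t.x = a := rfl
      omega
end

section
/- For every integer n ≥ 1, let f(n) = 16n⁴ + 32n³ + 24n² + 12n + 3. Then ⌊√f(n)⌋ = 4n² + 4n + 1, and the simple continued fraction expansion of √f(n) + 4n² + 4n + 1 is purely periodic with period 2: its partial quotients satisfy a_{2i} = 8n² + 8n + 2 and a_{2i+1} = 2n + 1 for all i ≥ 0. -/
/-- For `k ≥ 1`, the integer part of `√(k⁴ + 2k)` is `k²`, with nonzero fractional part. -/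
theorem sq_lt_sqrt_and_sqrt_lt {k : ℝ} (hk : 1 ≤ k) :
    k ^ 2 < √(k ^ 4 + 2 * k) ∧ √(k ^ 4 + 2 * k) < k ^ 2 + 1 := by
  constructor
  · apply Real.lt_sqrt_of_sq_lt
    nlinarith
  · rw [Real.sqrt_lt' (by positivity)]
    nlinarith

/-- If `s² = k⁴ + 2k` and `k² < s < k² + 1`, then a complete quotient `s + k²` has partial quotient
`2k²` and is followed by `(s + k²) / (2k)`. -/
theorem floor_add_sq_and_next {k : ℤ} (hk : 1 ≤ k) {s : ℝ} (hs : s ^ 2 = (k : ℝ) ^ 4 + 2 * k)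
    (hlo : (k : ℝ) ^ 2 < s) (hhi : s < (k : ℝ) ^ 2 + 1) :
    ⌊s + (k : ℝ) ^ 2⌋ = 2 * k ^ 2 ∧
      (s + (k : ℝ) ^ 2 - (⌊s + (k : ℝ) ^ 2⌋ : ℝ))⁻¹ = (s + (k : ℝ) ^ 2) / (2 * k) := by
  have hk' : (1 : ℝ) ≤ k := by exact_mod_cast hk
  have hfloor : ⌊s + (k : ℝ) ^ 2⌋ = 2 * k ^ 2 := by
    rw [Int.floor_eq_iff]
    push_cast
    constructor <;> linarith
  refine ⟨hfloor, ?_⟩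
  rw [hfloor]
  apply inv_eq_of_mul_eq_one_right
  push_cast
  field_simp
  linear_combination hs

/-- If `s² = k⁴ + 2k` and `k² < s < k² + 1`, then a complete quotient `(s + k²) / (2k)` has partial
quotient `k` and is followed by `s + k²`. -/
theorem floor_div_and_next {k : ℤ} (hk : 1 ≤ k) {s : ℝ} (hs : s ^ 2 = (k : ℝ) ^ 4 + 2 * k)
    (hlo : (k : ℝ) ^ 2 < s) (hhi : s < (k : ℝ) ^ 2 + 1) :
    ⌊(s + (k : ℝ) ^ 2) / (2 * k)⌋ = k ∧
      ((s + (k : ℝ) ^ 2) / (2 * k) - (⌊(s + (k : ℝ) ^ 2) / (2 * k)⌋ : ℝ))⁻¹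
        = s + (k : ℝ) ^ 2 := by
  have hk' : (1 : ℝ) ≤ k := by exact_mod_cast hk
  have hfloor : ⌊(s + (k : ℝ) ^ 2) / (2 * k)⌋ = k := by
    rw [Int.floor_eq_iff, le_div_iff₀ (by positivity), div_lt_iff₀ (by positivity)]
    constructor <;> nlinarith
  refine ⟨hfloor, ?_⟩
  rw [hfloor]
  apply inv_eq_of_mul_eq_one_right
  field_simp
  linear_combination hs

/-- For `f(n) = 16n⁴ + 32n³ + 24n² + 12n + 3` (with `n ≥ 1`), `⌊√f(n)⌋ = 4n² + 4n + 1`,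
and the simple continued fraction expansion of `√f(n) + 4n² + 4n + 1` is purely periodic
with period 2 and partial quotients `a_{2i} = 8n² + 8n + 2`, `a_{2i+1} = 2n + 1`:
with complete quotients `x 0 = √f(n) + 4n² + 4n + 1`, `x (i+1) = 1 / (x i - ⌊x i⌋)`, the
partial quotients `a i = ⌊x i⌋` satisfy `a (2i) = 8n² + 8n + 2` and `a (2i+1) = 2n + 1`. -/
theorem continued_fraction_sqrt_quartic
    (n : ℕ) (hn : 1 ≤ n) (x : ℕ → ℝ)
    (hx0 : x 0 = Real.sqrt (16 * (n : ℝ) ^ 4 + 32 * (n : ℝ) ^ 3 + 24 * (n : ℝ) ^ 2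
      + 12 * (n : ℝ) + 3) + (4 * (n : ℝ) ^ 2 + 4 * (n : ℝ) + 1))
    (hrec : ∀ i : ℕ, x (i + 1) = (x i - (⌊x i⌋ : ℝ))⁻¹) :
    ⌊Real.sqrt (16 * (n : ℝ) ^ 4 + 32 * (n : ℝ) ^ 3 + 24 * (n : ℝ) ^ 2
        + 12 * (n : ℝ) + 3)⌋ = 4 * (n : ℤ) ^ 2 + 4 * (n : ℤ) + 1 ∧
    ∀ i : ℕ, ⌊x (2 * i)⌋ = 8 * (n : ℤ) ^ 2 + 8 * (n : ℤ) + 2 ∧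
      ⌊x (2 * i + 1)⌋ = 2 * (n : ℤ) + 1 := by
  obtain ⟨k, hkn⟩ : ∃ k : ℤ, k = 2 * (n : ℤ) + 1 := ⟨_, rfl⟩
  have hk : 1 ≤ k := by omega
  have hkR : (k : ℝ) = 2 * (n : ℝ) + 1 := by rw [hkn]; push_cast; ring
  have hk' : (1 : ℝ) ≤ k := by exact_mod_cast hk
  have hf : 16 * (n : ℝ) ^ 4 + 32 * (n : ℝ) ^ 3 + 24 * (n : ℝ) ^ 2 + 12 * (n : ℝ) + 3
      = (k : ℝ) ^ 4 + 2 * k := by rw [hkR]; ring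
  have hm : 4 * (n : ℝ) ^ 2 + 4 * (n : ℝ) + 1 = (k : ℝ) ^ 2 := by rw [hkR]; ring
  rw [hf, hm] at hx0
  rw [hf]
  obtain ⟨hlo, hhi⟩ := sq_lt_sqrt_and_sqrt_lt hk'
  have hs : √((k : ℝ) ^ 4 + 2 * k) ^ 2 = (k : ℝ) ^ 4 + 2 * k := Real.sq_sqrt (by positivity)
  obtain ⟨heven, heven_next⟩ := floor_add_sq_and_next hk hs hlo hhi
  obtain ⟨hodd, hodd_next⟩ := floor_div_and_next hk hs hlo hhi
  have hx_even : ∀ i : ℕ, x (2 * i) = √((k : ℝ) ^ 4 + 2 * k) + (k : ℝ) ^ 2 := by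
    intro i
    induction i with
    | zero => exact hx0
    | succ i ih => rw [Nat.mul_succ, hrec, hrec, ih, heven_next, hodd_next]
  refine ⟨?_, fun i => ⟨?_, ?_⟩⟩
  · rw [Int.floor_eq_iff]
    push_cast
    constructor <;> linarith
  · rw [hx_even, heven, hkn]
    ring
  · rw [hrec, hx_even, heven_next, hodd, hkn]
end

section
/- Let n ≥ 1 be an integer such that f(n) = 16n⁴ + 32n³ + 24n² + 12n + 3 is squarefree, and let K = ℚ(√f(n)) with ring of integers 𝒪_K. Then ε = (2n+1)³ + 1 + (2n+1)√f(n) is a totally positive unit of 𝒪_K, and every totally positive unit of 𝒪_K is an integer power of ε (that is, ε is the totally positive fundamental unit of K). -/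
open NumberField

/-- A rational number whose square becomes integral after multiplication by a squarefree
integer is itself an integer. -/
lemma exists_intCast_eq_of_squarefree_mul_sq {D : ℤ} (hD : Squarefree D) {s : ℚ} {M : ℤ}
    (h : (D : ℚ) * s ^ 2 = M) : ∃ c : ℤ, s = c := by
  have hden : (s.den : ℚ) ≠ 0 := by exact_mod_cast s.den_ne_zero
  have h1 : D * s.num ^ 2 = M * (s.den : ℤ) ^ 2 := by
    have h2 : (D : ℚ) * s.num ^ 2 = M * (s.den : ℚ) ^ 2 := by
      rw [← h]
      nth_rewrite 2 [← Rat.num_div_den s]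
      field_simp
    exact_mod_cast h2
  have hcop : IsCoprime ((s.den : ℤ) ^ 2) (s.num ^ 2) :=
    (Int.isCoprime_iff_nat_coprime.2 (by simpa using s.reduced.symm)).pow
  have hdvd : (s.den : ℤ) * s.den ∣ D := by
    rw [← sq]
    exact hcop.dvd_of_dvd_mul_right ⟨M, by rw [h1]; ring⟩
  have hone : s.den = 1 := by simpa [Int.isUnit_iff_natAbs_eq] using hD _ hdvd
  exact ⟨s.num, ((Rat.den_eq_one_iff s).1 hone).symm⟩

lemma Int.not_isSquare_of_emod_four_eq_three {D : ℤ} (hD : D % 4 = 3) : ¬ IsSquare D := by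
  rintro ⟨r, rfl⟩
  rcases Int.emod_two_eq_zero_or_one r with h | h
  · obtain ⟨k, rfl⟩ := Int.dvd_of_emod_eq_zero h
    ring_nf at hD
    omega
  · obtain ⟨k, rfl⟩ : ∃ k, r = 2 * k + 1 := ⟨r / 2, by omega⟩
    ring_nf at hD
    omega

section Quadratic

variable {K : Type*} [Field K] {D : ℤ} {α : K}

lemma eq_zero_of_ratCast_add_mul_sqrt_eq_zero [CharZero K] (hD : ¬ IsSquare D)
    (hα : α ^ 2 = D) {p q : ℚ} (h : (p : K) + q * α = 0) : p = 0 ∧ q = 0 := by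
  have hq : q = 0 := by
    by_contra hq
    refine hD (Rat.isSquare_intCast_iff.1 ⟨p / q, ?_⟩)
    have h1 : (D : K) * (q : K) ^ 2 = (p : K) ^ 2 := by
      rw [← hα]
      linear_combination (q * α - p) * h
    have h2 : (D : ℚ) * q ^ 2 = p ^ 2 := by exact_mod_cast h1
    field_simp
    linarith
  subst hq
  exact ⟨by simpa using h, rfl⟩

lemma intCast_add_mul_sqrt_inj [CharZero K] (hD : ¬ IsSquare D) (hα : α ^ 2 = D)
    {a b c d : ℤ} (h : (a : K) + b * α = c + d * α) : a = c ∧ b = d := by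
  obtain ⟨h1, h2⟩ := eq_zero_of_ratCast_add_mul_sqrt_eq_zero hD hα
    (p := (a - c : ℤ)) (q := (b - d : ℤ)) (by push_cast; linear_combination h)
  norm_cast at h1 h2
  omega

lemma pos_of_norm_eq_one (hα : α ^ 2 = D) (φ : K →+* ℝ) {a b : ℤ} (h : a ^ 2 - D * b ^ 2 = 1) :
    0 < φ (a + b * α) ↔ 0 < a := by
  have hφ : φ α ^ 2 = D := by rw [← map_pow, hα, map_intCast]
  have hprod : ((a : ℝ) + b * φ α) * (a - b * φ α) = 1 := by
    have h' : (a : ℝ) ^ 2 - D * b ^ 2 = 1 := by exact_mod_cast h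
    linear_combination h' - b ^ 2 * hφ
  rw [map_add, map_mul, map_intCast, map_intCast, ← Int.cast_pos (R := ℝ)]
  constructor
  · intro hpos
    have := pos_of_mul_pos_right (hprod ▸ one_pos) hpos.le
    linarith
  · intro hpos
    by_contra! hneg
    nlinarith

/-- Solutions of the Pell equation `x² - D y² = 1` as units `x + y√D`. -/
noncomputable def pellToUnits (β : 𝓞 K) (hβ : β * β = (D : 𝓞 K)) :
    Pell.Solution₁ D →* (𝓞 K)ˣ :=
  (Units.map (Zsqrtd.lift ⟨β, hβ⟩).toMonoidHom).comp Unitary.toUnits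

lemma coe_pellToUnits (β : 𝓞 K) (hβ : β * β = (D : 𝓞 K)) (a : Pell.Solution₁ D) :
    ((pellToUnits β hβ a : 𝓞 K) : K) = a.x + a.y * β := by
  have h : (pellToUnits β hβ a : 𝓞 K) = a.x + a.y * β := rfl
  rw [h]
  simp

variable [NumberField K]

lemma exists_eq_ratCast_add_mul_sqrt (hrank : Module.finrank ℚ K = 2) (hD : ¬ IsSquare D)
    (hα : α ^ 2 = D) (x : K) : ∃ p q : ℚ, x = p + q * α := by
  have hli : LinearIndependent ℚ ![(1 : K), α] := by
    rw [LinearIndependent.pair_iff]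
    intro p q h
    exact eq_zero_of_ratCast_add_mul_sqrt_eq_zero hD hα (by simpa [Rat.smul_def] using h)
  have hspan := hli.span_eq_top_of_card_eq_finrank' (by simp [hrank])
  have hx : x ∈ Submodule.span ℚ (Set.range ![(1 : K), α]) := hspan ▸ Submodule.mem_top
  rw [Matrix.range_cons, Matrix.range_cons, Matrix.range_empty, Set.union_empty,
    Set.singleton_union, Submodule.mem_span_pair] at hx
  obtain ⟨p, q, h⟩ := hx
  exact ⟨p, q, by simpa [Rat.smul_def] using h.symm⟩

/-- An integral element `p + q√D` of a quadratic field has integral trace and norm. -/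
lemma exists_trace_norm_of_isIntegral (hD : ¬ IsSquare D) (hα : α ^ 2 = D)
    {p q : ℚ} (hx : IsIntegral ℤ ((p : K) + q * α)) :
    ∃ t N : ℤ, 2 * p = t ∧ p ^ 2 - D * q ^ 2 = N := by
  by_cases hq : q = 0
  · subst hq
    have hp : IsIntegral ℤ p := by
      rw [← isIntegral_algebraMap_iff (algebraMap ℚ K).injective]
      simpa using hx
    obtain ⟨a, rfl⟩ := IsIntegrallyClosed.isIntegral_iff.1 hp
    exact ⟨2 * a, a ^ 2, by simp, by simp⟩
  · set x : K := p + q * α with hxdef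
    let P : Polynomial ℚ := Polynomial.X ^ 2 + Polynomial.C (-(2 * p)) * Polynomial.X +
      Polynomial.C (p ^ 2 - D * q ^ 2)
    have hPdeg : P.natDegree = 2 := by simp only [P]; compute_degree!
    have hPmonic : P.Monic := by simp only [P]; monicity!
    have hPx : Polynomial.aeval x P = 0 := by
      simp only [P, hxdef, map_add, map_mul, map_pow, Polynomial.aeval_X, Polynomial.aeval_C,
        eq_ratCast]
      push_cast
      linear_combination (q : K) ^ 2 * hα
    have hxQ : IsIntegral ℚ x := ⟨P, hPmonic, hPx⟩
    have hle : 2 ≤ (minpoly ℚ x).natDegree := by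
      rw [minpoly.two_le_natDegree_iff hxQ]
      rintro ⟨r, hr⟩
      refine hq (eq_zero_of_ratCast_add_mul_sqrt_eq_zero (p := p - r) hD hα ?_).2
      rw [eq_ratCast] at hr
      push_cast
      linear_combination hxdef.symm.trans hr.symm
    have hP : P = minpoly ℚ x :=
      Polynomial.eq_of_monic_of_dvd_of_natDegree_le (minpoly.monic hxQ) hPmonic
        (minpoly.dvd ℚ x hPx) (by omega)
    rw [minpoly.isIntegrallyClosed_eq_field_fractions' ℚ hx] at hP
    have h1 := congrArg (Polynomial.coeff · 1) hP
    have h0 := congrArg (Polynomial.coeff · 0) hP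
    simp only [P, Polynomial.coeff_add, Polynomial.coeff_X_pow, Polynomial.coeff_C_mul,
      Polynomial.coeff_X, Polynomial.coeff_C, Polynomial.coeff_map, eq_intCast] at h1 h0
    norm_num at h1 h0
    refine ⟨-(minpoly ℤ x).coeff 1, (minpoly ℤ x).coeff 0, ?_, ?_⟩
    · push_cast
      linarith
    · linarith

lemma exists_eq_intCast_add_mul_sqrt (hrank : Module.finrank ℚ K = 2) (hsf : Squarefree D)
    (hD : D % 4 = 3) (hα : α ^ 2 = D) (x : 𝓞 K) : ∃ a b : ℤ, (x : K) = a + b * α := by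
  have hns := Int.not_isSquare_of_emod_four_eq_three hD
  obtain ⟨p, q, h⟩ := exists_eq_ratCast_add_mul_sqrt hrank hns hα x
  have hx : IsIntegral ℤ ((p : K) + q * α) := by
    rw [← h]
    exact x.isIntegral_coe
  obtain ⟨t, N, ht, hN⟩ := exists_trace_norm_of_isIntegral hns hα hx
  have hs : (D : ℚ) * (2 * q) ^ 2 = (t ^ 2 - 4 * N : ℤ) := by
    push_cast
    rw [← ht, ← hN]
    ring
  obtain ⟨s, hsq⟩ := exists_intCast_eq_of_squarefree_mul_sq hsf hs
  rw [hsq] at hs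
  have hs' : D * s ^ 2 = t ^ 2 - 4 * N := by exact_mod_cast hs
  obtain ⟨k, hk⟩ : ∃ k, D = 4 * k + 3 := ⟨D / 4, by omega⟩
  have hmod : t ^ 2 + s ^ 2 = 4 * (N + k * s ^ 2 + s ^ 2) := by
    rw [hk] at hs'
    linear_combination -hs'
  have hpar : ∀ r : ℤ, (∃ l, r = 2 * l) ∨ ∃ l, r = 2 * l + 1 := fun r ↦ by
    rcases Int.emod_two_eq_zero_or_one r with h | h
    · exact .inl ⟨r / 2, by omega⟩
    · exact .inr ⟨r / 2, by omega⟩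
  obtain ⟨a, ha⟩ | ⟨a, ha⟩ := hpar t <;> obtain ⟨b, hb⟩ | ⟨b, hb⟩ := hpar s
  · subst ha hb
    push_cast at ht hsq
    have hp : p = a := by linarith
    have hq : q = b := by linarith
    exact ⟨a, b, by simp [h, hp, hq]⟩
  all_goals
    exfalso
    subst ha hb
    generalize N + k * _ + _ = w at hmod
    ring_nf at hmod
    omega

lemma norm_eq_one_of_unit (hrank : Module.finrank ℚ K = 2) (hsf : Squarefree D)
    (hD : D % 4 = 3) (hα : α ^ 2 = D) (u : (𝓞 K)ˣ) {a b : ℤ}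
    (hu : ((u : 𝓞 K) : K) = a + b * α) : a ^ 2 - D * b ^ 2 = 1 := by
  have hns := Int.not_isSquare_of_emod_four_eq_three hD
  obtain ⟨c, d, hv⟩ := exists_eq_intCast_add_mul_sqrt hrank hsf hD hα (u⁻¹ : (𝓞 K)ˣ)
  have huv : ((u : 𝓞 K) : K) * ((u⁻¹ : (𝓞 K)ˣ) : 𝓞 K) = 1 := by
    rw [← map_mul, Units.mul_inv, map_one]
  rw [hu, hv] at huv
  obtain ⟨h1, h2⟩ := intCast_add_mul_sqrt_inj hns hα (a := a * c + D * (b * d))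
    (b := a * d + b * c) (c := 1) (d := 0) (by
      push_cast
      linear_combination huv - b * d * hα)
  have hunit : IsUnit (a ^ 2 - D * b ^ 2) := by
    refine IsUnit.of_mul_eq_one (c ^ 2 - D * d ^ 2) ?_
    linear_combination (a * c + D * (b * d) + 1) * h1 - D * (a * d + b * c) * h2
  refine (Int.isUnit_iff.1 hunit).resolve_right fun hneg ↦ ?_
  obtain ⟨k, hk⟩ : ∃ k, D = 4 * k + 3 := ⟨D / 4, by omega⟩
  have hmod : a ^ 2 + b ^ 2 = 4 * (k * b ^ 2 + b ^ 2) - 1 := by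
    rw [hk] at hneg
    linear_combination hneg
  generalize k * b ^ 2 + b ^ 2 = w at hmod
  have hsq : ∀ r : ℤ, r ^ 2 % 4 = 0 ∨ r ^ 2 % 4 = 1 := fun r ↦ by
    rcases Int.emod_two_eq_zero_or_one r with h | h
    · obtain ⟨l, rfl⟩ : ∃ l, r = 2 * l := ⟨r / 2, by omega⟩
      ring_nf
      omega
    · obtain ⟨l, rfl⟩ : ∃ l, r = 2 * l + 1 := ⟨r / 2, by omega⟩
      ring_nf
      omega
  have := hsq a
  have := hsq b
  omega

lemma nonempty_ringHom_real (hrank : Module.finrank ℚ K = 2) (hD : ¬ IsSquare D)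
    (hD0 : 0 ≤ D) (hα : α ^ 2 = D) : Nonempty (K →+* ℝ) := by
  obtain ⟨φ⟩ : Nonempty (K →+* ℂ) := inferInstance
  have hφα : (starRingEnd ℂ) (φ α) = φ α := by
    have h : φ α ^ 2 = ((√(D : ℝ) : ℝ) : ℂ) ^ 2 := by
      rw [← map_pow, hα, map_intCast, ← Complex.ofReal_pow,
        Real.sq_sqrt (by exact_mod_cast hD0), Complex.ofReal_intCast]
    rcases sq_eq_sq_iff_eq_or_eq_neg.1 h with h | h <;> rw [h] <;> simp
  have hreal : ComplexEmbedding.IsReal φ := by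
    rw [ComplexEmbedding.isReal_iff]
    ext x
    obtain ⟨p, q, rfl⟩ := exists_eq_ratCast_add_mul_sqrt hrank hD hα x
    simp [ComplexEmbedding.conjugate_coe_eq, hφα]
  exact ⟨hreal.embedding⟩

end Quadratic

/-- For `m ≥ 2`, the fundamental solution of the Pell equation with `D = m⁴ + 2m`. -/
lemma isFundamental_pell {m D : ℤ} (hm : 2 ≤ m) (hD : D = m ^ 4 + 2 * m)
    (h : (m ^ 3 + 1) ^ 2 - D * m ^ 2 = 1) :
    Pell.IsFundamental (Pell.Solution₁.mk (m ^ 3 + 1) m h) := by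
  have hm3 : 0 < m ^ 3 := by positivity
  refine ⟨by simpa using hm3, by simp; omega, fun {b} hb ↦ ?_⟩
  rw [Pell.Solution₁.x_mk]
  wlog hy : 0 < b.y generalizing b
  · have hy0 := Pell.Solution₁.y_ne_zero_of_one_lt_x hb
    simpa using this (b := b⁻¹) (by simpa using hb) (by simp; omega)
  have hp := b.prop
  generalize b.x = x at *
  generalize b.y = y at *
  subst hD
  have hxy : m ^ 2 * y < x := by
    refine lt_of_pow_lt_pow_left₀ 2 (by omega) ?_
    nlinarith [mul_pos (show 0 < m by omega) (pow_pos hy 2)]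
  obtain ⟨r, hr, rfl⟩ : ∃ r, 1 ≤ r ∧ x = m ^ 2 * y + r := ⟨x - m ^ 2 * y, by omega, by ring⟩
  have hmy : m ≤ y := by
    by_contra! hlt
    have h1 : 2 * m ^ 2 * y * r + r ^ 2 = 2 * m * y ^ 2 + 1 := by linear_combination hp
    have h2 : 2 * m ^ 2 * y ≤ 2 * m ^ 2 * y * r := le_mul_of_one_le_right (by positivity) hr
    have h3 : 0 < 2 * m * y * (m - y) :=  by
      have : 0 < m - y := by omega
      positivity
    nlinarith
  nlinarith [mul_le_mul_of_nonneg_left hmy (sq_nonneg m)]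

/-- Let `n ≥ 1` with `f(n) = 16n⁴ + 32n³ + 24n² + 12n + 3` squarefree, and let
`K = ℚ(√f(n))` (an abstract number field of degree 2 over ℚ containing an element `α`
with `α² = f(n)`).  Then `ε = (2n+1)³ + 1 + (2n+1)·α` is a totally positive unit of
`𝒪_K`, and every totally positive unit of `𝒪_K` is an integer power of `ε`. -/
theorem totally_positive_fundamental_unit_quartic
    (n : ℕ) (hn : 1 ≤ n)
    (hsf : Squarefree (16 * n ^ 4 + 32 * n ^ 3 + 24 * n ^ 2 + 12 * n + 3))
    (K : Type*) [Field K] [NumberField K] (hrank : Module.finrank ℚ K = 2)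
    (α : K)
    (hα : α ^ 2 = 16 * (n : K) ^ 4 + 32 * (n : K) ^ 3 + 24 * (n : K) ^ 2 + 12 * (n : K) + 3) :
    ∃ ε : (𝓞 K)ˣ,
      (((ε : 𝓞 K) : K) = (2 * (n : K) + 1) ^ 3 + 1 + (2 * (n : K) + 1) * α) ∧
      (∀ φ : K →+* ℝ, 0 < φ ((ε : 𝓞 K) : K)) ∧
      (∀ u : (𝓞 K)ˣ, (∀ φ : K →+* ℝ, 0 < φ ((u : 𝓞 K) : K)) → ∃ k : ℤ, u = ε ^ k) := by
  obtain ⟨D, hDdef⟩ : ∃ D : ℤ,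
      D = ((16 * n ^ 4 + 32 * n ^ 3 + 24 * n ^ 2 + 12 * n + 3 : ℕ) : ℤ) := ⟨_, rfl⟩
  have hsfD : Squarefree D := hDdef ▸ Int.squarefree_natCast.2 hsf
  have hD4 : D % 4 = 3 := by omega
  have hD0 : 0 ≤ D := by omega
  have hns := Int.not_isSquare_of_emod_four_eq_three hD4
  have hαD : α ^ 2 = D := by
    rw [hα, hDdef]
    push_cast
    ring
  obtain ⟨m, hmdef⟩ : ∃ m : ℤ, m = 2 * n + 1 := ⟨_, rfl⟩
  have hDm : D = m ^ 4 + 2 * m := by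
    rw [hDdef, hmdef]
    push_cast
    ring
  have hpell : (m ^ 3 + 1) ^ 2 - D * m ^ 2 = 1 := by
    rw [hDm]
    ring
  have hfund := isFundamental_pell (by omega) hDm hpell
  set a := Pell.Solution₁.mk (m ^ 3 + 1) m hpell
  have hαint : IsIntegral ℤ α := by
    refine IsIntegral.of_pow two_pos ?_
    rw [hαD]
    exact isIntegral_algebraMap (R := ℤ) (x := D)
  let β : 𝓞 K := ⟨α, hαint⟩
  have hβ : β * β = (D : 𝓞 K) := by
    apply RingOfIntegers.ext
    rw [← sq]
    exact hαD
  refine ⟨pellToUnits β hβ a, ?_, fun φ ↦ ?_, fun u hu ↦ ?_⟩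
  · rw [coe_pellToUnits, Pell.Solution₁.x_mk, Pell.Solution₁.y_mk, hmdef]
    push_cast
    rfl
  · rw [coe_pellToUnits]
    exact (pos_of_norm_eq_one hαD φ a.prop).2 hfund.x_pos
  · obtain ⟨x, y, hxy⟩ := exists_eq_intCast_add_mul_sqrt hrank hsfD hD4 hαD u
    have hnorm := norm_eq_one_of_unit hrank hsfD hD4 hαD u hxy
    obtain ⟨φ⟩ := nonempty_ringHom_real hrank hns hD0 hαD
    have hx : 0 < x := (pos_of_norm_eq_one hαD φ hnorm).1 (hxy ▸ hu φ)
    let b := Pell.Solution₁.mk x y hnorm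
    have hub : u = pellToUnits β hβ b := by
      apply Units.ext
      apply RingOfIntegers.ext
      rw [hxy, coe_pellToUnits]
      rfl
    obtain ⟨k, hk | hk⟩ := hfund.eq_zpow_or_neg_zpow b
    · exact ⟨k, by rw [hub, hk, map_zpow]⟩
    · have hpos := Pell.Solution₁.x_zpow_pos hfund.x_pos k
      have hneg : x = -(a ^ k).x := congrArg Pell.Solution₁.x hk
      omega
end

section
/- Let u > 1 be a real number, and let ℤ act on the open positive quadrant (0,∞)² by k·(a,b) = (u^k a, u^{−k} b). Then the set D = { x·(1,1) + y·(u^{−1}, u) : x > 0, y ≥ 0 } is a fundamental domain for this action: for every (a,b) with a > 0 and b > 0 there exists a unique integer k such that (u^k a, u^{−k} b) ∈ D. -/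
/-- The half-open cone spanned by `(1,1)` and `(u⁻¹, u)` is cut out by two linear inequalities. -/
lemma exists_cone_coordinates_iff {u : ℝ} (hu : 1 < u) (p q : ℝ) :
    (∃ x y : ℝ, 0 < x ∧ 0 ≤ y ∧ (p, q) = (x * 1 + y * u⁻¹, x * 1 + y * u)) ↔
      p ≤ q ∧ q < u ^ 2 * p := by
  have hu0 : 0 < u := by linarith
  have hd : 0 < u ^ 2 - 1 := by nlinarith
  constructor
  · rintro ⟨x, y, hx, hy, h⟩
    obtain ⟨rfl, rfl⟩ := Prod.mk.inj h
    have hinv : u⁻¹ ≤ u := (inv_le_one_of_one_le₀ hu.le).trans hu.le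
    have hmul : u ^ 2 * (x * 1 + y * u⁻¹) = u ^ 2 * x + y * u := by field_simp
    refine ⟨by gcongr, ?_⟩
    rw [hmul]
    nlinarith [mul_pos hd hx]
  · rintro ⟨hpq, hqp⟩
    refine ⟨(u ^ 2 * p - q) / (u ^ 2 - 1), u * (q - p) / (u ^ 2 - 1),
      div_pos (by linarith) hd, div_nonneg (mul_nonneg hu0.le (by linarith)) hd.le, ?_⟩
    have hd' := hd.ne'
    ext
    · field_simp
      ring
    · field_simp
      ring

lemma existsUnique_zpow_le_lt {v r : ℝ} (hv : 1 < v) (hr : 0 < r) :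
    ∃! k : ℤ, v ^ k ≤ r ∧ r < v ^ (k + 1) := by
  obtain ⟨k, hk⟩ := exists_mem_Ico_zpow hr hv
  refine ⟨k, hk, fun m hm => ?_⟩
  have h₁ := (zpow_lt_zpow_iff_right₀ hv).1 (hm.1.trans_lt hk.2)
  have h₂ := (zpow_lt_zpow_iff_right₀ hv).1 (hk.1.trans_lt hm.2)
  lia

/-- For a real number `u > 1`, the set `D = { x·(1,1) + y·(u⁻¹, u) : x > 0, y ≥ 0 }` is a
fundamental domain for the ℤ-action `k · (a,b) = (uᵏ a, u⁻ᵏ b)` on the open positive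
quadrant: every `(a,b)` with `a, b > 0` satisfies `(uᵏ a, u⁻ᵏ b) ∈ D` for a unique `k`. -/
theorem fundamental_domain_unit_action
    (u : ℝ) (hu : 1 < u) :
    ∀ a b : ℝ, 0 < a → 0 < b →
      ∃! k : ℤ, (u ^ k * a, u ^ (-k) * b) ∈
        {p : ℝ × ℝ | ∃ x y : ℝ, 0 < x ∧ 0 ≤ y ∧
          p = (x * 1 + y * u⁻¹, x * 1 + y * u)} := by
  intro a b ha hb
  have hu0 : 0 < u := by linarith
  have hv : 1 < u ^ 2 := by nlinarith
  refine (existsUnique_congr fun k => ?_).mpr (existsUnique_zpow_le_lt hv (div_pos hb ha))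
  rw [Set.mem_ofPred_eq, exists_cone_coordinates_iff hu, zpow_add_one₀ (by positivity),
    le_div_iff₀ ha, div_lt_iff₀ ha]
  have hk : 0 < u ^ k := zpow_pos hu0 k
  have hsq : (u ^ 2) ^ k = u ^ k * u ^ k := by rw [pow_two, mul_zpow]
  rw [zpow_neg, inv_mul_eq_div, le_div_iff₀ hk, div_lt_iff₀ hk, hsq]
  ring_nf
end
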